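/- Let h : ℝ → ℂ be a function in the class H, and for ξ ∈ ℝ and T ≥ 2 set Q(ξ;T) = ∑_{0<γ≤T} e^{2πiγξ}, the sum over imaginary parts γ of nontrivial zeros of the Riemann zeta function with 0 < γ ≤ T counted with multiplicity. Then for all U ≥ 1 and T ≥ 2, | ∫_U^{∞} ĥ(ξ)·|Q(ξ;T)|² dξ | ≪_h T·(log T)³/U⁴ + T·(log T)²/U³. -/

import Mathlib

open Complex MeasureTheory
open scoped Classical

/-- The multiplicity (order of vanishing) of `f` at `ρ`. -/
noncomputable def zeroMult (f : ℂ → ℂ) (ρ : ℂ) : ℕ :=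
  sSup {n : ℕ | ∃ g : ℂ → ℂ, AnalyticAt ℂ g ρ ∧ ∀ᶠ z in nhds ρ, f z = (z - ρ) ^ n * g z}

/-- The Fourier transform `ĥ(ξ) = ∫ h(x) e^{-2πixξ} dx`. -/
noncomputable def FT (h : ℝ → ℂ) (ξ : ℝ) : ℂ :=
  ∫ x : ℝ, h x * Complex.exp (-(2 * Real.pi * Complex.I * x * ξ))

/-- The class `H`: `∫ h = 0`, `∫ |x h(x)| dx < ∞`, and `|ĥ'(ξ)| ≪ |ξ|^{-5}` for `|ξ| ≥ 1`. -/
structure MemH (h : ℝ → ℂ) : Prop where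
  integrable : Integrable h
  integral_zero : ∫ x : ℝ, h x = 0
  xh_integrable : Integrable (fun x : ℝ => (x : ℂ) * h x)
  ft_deriv_decay : ∃ C : ℝ, ∀ ξ : ℝ, 1 ≤ |ξ| → ‖deriv (FT h) ξ‖ ≤ C * |ξ| ^ (-5 : ℝ)

/-- `ρ` lies in the box of nontrivial zeros with `0 < Im ρ ≤ T`. -/
def inZeroBox (ρ : ℂ) (T : ℝ) : Prop :=
  0 < ρ.re ∧ ρ.re < 1 ∧ 0 < ρ.im ∧ ρ.im ≤ T

/-- `Q(ξ;T) = ∑_{0<γ≤T} e^{2πiγξ}`, over imaginary parts of nontrivial zeros of `ζ` counted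
with multiplicity. -/
noncomputable def Qzeta (ξ T : ℝ) : ℂ :=
  ∑' ρ : ℂ,
    if inZeroBox ρ T then
      (zeroMult riemannZeta ρ : ℂ) * Complex.exp (2 * Real.pi * Complex.I * ρ.im * ξ)
    else 0

lemma hasDerivAt_ofReal_cpow {y : ℝ} (hy : 0 < y) (r : ℂ) :
    HasDerivAt (fun x : ℝ => (x : ℂ) ^ r) (r * (y : ℂ) ^ (r - 1)) y := by
  rcases eq_or_ne r 0 with rfl | hr
  · simpa using hasDerivAt_const y (1 : ℂ)
  · exact hasDerivAt_ofReal_cpow_const hy.ne' hr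

/-- `s - 1` times the error of the trapezoidal rule for `∫ x ^ (-s)` on `[a, a + 1]`. -/
noncomputable def trapezoidError (a : ℝ) (s : ℂ) : ℂ :=
  (s - 1) / 2 * ((a : ℂ) ^ (-s) + ((a + 1 : ℝ) : ℂ) ^ (-s)) +
    (((a + 1 : ℝ) : ℂ) ^ (1 - s) - (a : ℂ) ^ (1 - s))

lemma norm_trapezoidError_le {a : ℝ} (ha : 0 < a) {s : ℂ} (hs : -2 ≤ s.re) :
    ‖trapezoidError a s‖ ≤ ‖s - 1‖ * ‖s‖ * ‖s + 1‖ / 2 * a ^ (-s.re - 2) := by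
  set B : ℝ := ‖s - 1‖ * ‖s‖ * ‖s + 1‖ / 2 * a ^ (-s.re - 2) with hB
  set E : ℝ → ℂ := fun y => (s - 1) / 2 * ((y - a : ℝ) * ((a : ℂ) ^ (-s) + (y : ℂ) ^ (-s))) +
    ((y : ℂ) ^ (1 - s) - (a : ℂ) ^ (1 - s)) with hE
  set E' : ℝ → ℂ := fun y => (s - 1) / 2 * ((a : ℂ) ^ (-s) - (y : ℂ) ^ (-s)
    - s * ((y - a : ℝ) * (y : ℂ) ^ (-s - 1))) with hE'
  set E'' : ℝ → ℂ := fun y => (s - 1) / 2 * (s * (s + 1) * ((y - a : ℝ) * (y : ℂ) ^ (-s - 2)))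
    with hE''
  have hlin (y : ℝ) : HasDerivAt (fun y : ℝ => ((y - a : ℝ) : ℂ)) 1 y := by
    simpa using ((hasDerivAt_id y).sub_const a).ofReal_comp
  have hd1 (y : ℝ) (hy : 0 < y) : HasDerivAt E (E' y) y := by
    have h1 := hasDerivAt_ofReal_cpow hy (-s)
    have h2 := hasDerivAt_ofReal_cpow hy (1 - s)
    have h3 := (((hlin y).mul (h1.const_add ((a : ℂ) ^ (-s)))).const_mul ((s - 1) / 2)).add
      (h2.sub_const ((a : ℂ) ^ (1 - s)))
    refine h3.congr_deriv ?_
    have : (1 - s - 1 : ℂ) = -s := by ring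
    rw [this]; simp only [hE']; ring
  have hd2 (y : ℝ) (hy : 0 < y) : HasDerivAt E' (E'' y) y := by
    have h1 := hasDerivAt_ofReal_cpow hy (-s)
    have h2 := hasDerivAt_ofReal_cpow hy (-s - 1)
    have h3 := ((h1.const_sub ((a : ℂ) ^ (-s))).sub
      (((hlin y).mul h2).const_mul s)).const_mul ((s - 1) / 2)
    refine h3.congr_deriv ?_
    have : (-s - 1 - 1 : ℂ) = -s - 2 := by ring
    rw [this]; simp only [hE'']; ring
  have pos {y : ℝ} (hy : y ∈ Set.Icc a (a + 1)) : 0 < y := ha.trans_le hy.1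
  have b2 : ∀ y ∈ Set.Icc a (a + 1), ‖E'' y‖ ≤ B := by
    intro y hy
    have hy1 : ‖((y - a : ℝ) : ℂ)‖ ≤ 1 := by
      rw [Complex.norm_real, Real.norm_of_nonneg (by linarith [hy.1])]; linarith [hy.2]
    have hy2 : ‖(y : ℂ) ^ (-s - 2)‖ ≤ a ^ (-s.re - 2) := by
      rw [norm_cpow_eq_rpow_re_of_pos (pos hy)]
      simpa using Real.rpow_le_rpow_of_nonpos ha hy.1 (by linarith : -s.re - 2 ≤ 0)
    calc ‖E'' y‖ = ‖s - 1‖ * ‖s‖ * ‖s + 1‖ / 2 * (‖((y - a : ℝ) : ℂ)‖ * ‖(y : ℂ) ^ (-s - 2)‖) := by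
          simp only [hE'', norm_mul, norm_div]; norm_num; ring
      _ ≤ ‖s - 1‖ * ‖s‖ * ‖s + 1‖ / 2 * (1 * a ^ (-s.re - 2)) := by gcongr
      _ = B := by rw [one_mul]
  have hB0 : 0 ≤ B := by positivity
  have ha1 : a ∈ Set.Icc a (a + 1) := ⟨le_rfl, by linarith⟩
  have b1 : ∀ y ∈ Set.Icc a (a + 1), ‖E' y‖ ≤ B := by
    intro y hy
    have := (convex_Icc a (a + 1)).norm_image_sub_le_of_norm_hasDerivWithin_le
      (fun x hx => (hd2 x (pos hx)).hasDerivWithinAt) b2 ha1 hy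
    have h0 : E' a = 0 := by simp [hE']
    rw [h0, sub_zero] at this
    refine this.trans (mul_le_of_le_one_right hB0 ?_)
    rw [Real.norm_of_nonneg (by linarith [hy.1])]; linarith [hy.2]
  have := (convex_Icc a (a + 1)).norm_image_sub_le_of_norm_hasDerivWithin_le
      (fun x hx => (hd1 x (pos hx)).hasDerivWithinAt) b1 ha1 ⟨by linarith, le_rfl⟩
  have h0 : E a = 0 := by simp [hE]
  have h1 : E (a + 1) = trapezoidError a s := by simp [hE, trapezoidError]
  rw [h0, h1, sub_zero] at this
  simpa using this

lemma differentiable_trapezoidError {a : ℝ} (ha : 0 < a) :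
    Differentiable ℂ (trapezoidError a) := by
  have h1 : (a : ℂ) ≠ 0 := by exact_mod_cast ha.ne'
  have h2 : ((a + 1 : ℝ) : ℂ) ≠ 0 := by exact_mod_cast (by positivity : a + 1 ≠ 0)
  intro s
  unfold trapezoidError
  have e1 : DifferentiableAt ℂ (fun s : ℂ => (a : ℂ) ^ (-s)) s :=
    differentiableAt_id.neg.const_cpow (Or.inl h1)
  have e2 : DifferentiableAt ℂ (fun s : ℂ => ((a + 1 : ℝ) : ℂ) ^ (-s)) s :=
    differentiableAt_id.neg.const_cpow (Or.inl h2)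
  have e3 : DifferentiableAt ℂ (fun s : ℂ => (a : ℂ) ^ (1 - s)) s :=
    (differentiableAt_id.const_sub 1).const_cpow (Or.inl h1)
  have e4 : DifferentiableAt ℂ (fun s : ℂ => ((a + 1 : ℝ) : ℂ) ^ (1 - s)) s :=
    (differentiableAt_id.const_sub 1).const_cpow (Or.inl h2)
  exact (((differentiableAt_id.sub_const 1).div_const 2).mul (e1.add e2)).add (e4.sub e3)

/-- The entire function `(s - 1) ζ(s)`. -/
noncomputable def entireZeta : ℂ → ℂ :=
  Function.update (fun s => (s - 1) * riemannZeta s) 1 1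

lemma entireZeta_of_ne_one {s : ℂ} (hs : s ≠ 1) : entireZeta s = (s - 1) * riemannZeta s :=
  Function.update_of_ne hs _ _

lemma analyticAt_entireZeta (s : ℂ) : AnalyticAt ℂ entireZeta s := by
  have hd {z : ℂ} (hz : z ≠ 1) : DifferentiableAt ℂ entireZeta z := by
    have : DifferentiableAt ℂ (fun s => (s - 1) * riemannZeta s) z :=
      (differentiableAt_id.sub_const 1).mul (differentiableAt_riemannZeta hz)
    refine this.congr_of_eventuallyEq ?_
    filter_upwards [isOpen_ne.mem_nhds hz] with w hw using entireZeta_of_ne_one hw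
  refine analyticAt_of_differentiable_on_punctured_nhds_of_continuousAt ?_ ?_
  · rcases eq_or_ne s 1 with rfl | hs
    · filter_upwards [self_mem_nhdsWithin] with z hz using hd hz
    · exact (Filter.eventually_of_mem (isOpen_ne.mem_nhds hs) fun z hz => hd hz).filter_mono
        nhdsWithin_le_nhds
  · rcases eq_or_ne s 1 with rfl | hs
    · exact continuousAt_update_same.2 riemannZeta_residue_one
    · exact (hd hs).continuousAt

lemma summable_rpow_neg_five_fourths :
    Summable (fun n : ℕ => ((n : ℝ) + 1) ^ (-(5 / 4) : ℝ)) := by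
  have := (summable_nat_add_iff 1).2 (Real.summable_nat_rpow.2 (by norm_num : (-(5 / 4) : ℝ) < -1))
  simpa using this

lemma norm_trapezoidError_nat_le {s : ℂ} (hs : -(3 / 4) ≤ s.re) (n : ℕ) :
    ‖trapezoidError (n + 1) s‖ ≤ (‖s‖ + 1) ^ 3 * ((n : ℝ) + 1) ^ (-(5 / 4) : ℝ) := by
  refine (norm_trapezoidError_le (by positivity) (by linarith)).trans ?_
  have h1 : ‖s - 1‖ ≤ ‖s‖ + 1 := (norm_sub_le _ _).trans (by simp)
  have h2 : ‖s + 1‖ ≤ ‖s‖ + 1 := (norm_add_le _ _).trans (by simp)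
  have h3 : ‖s‖ ≤ ‖s‖ + 1 := by linarith
  gcongr
  · calc ‖s - 1‖ * ‖s‖ * ‖s + 1‖ / 2 ≤ ‖s - 1‖ * ‖s‖ * ‖s + 1‖ := half_le_self (by positivity)
      _ ≤ (‖s‖ + 1) * (‖s‖ + 1) * (‖s‖ + 1) := by gcongr
      _ = _ := by ring
  · simp
  · linarith

lemma hasSum_trapezoidError {s : ℂ} (hs : 1 < s.re) :
    HasSum (fun n : ℕ => trapezoidError (n + 1) s) ((s - 1) * (riemannZeta s - 1 / 2) - 1) := by
  have hsum : Summable (fun n : ℕ => 1 / ((n : ℂ) + 1) ^ s) := by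
    have := (summable_nat_add_iff 1).2 (Complex.summable_one_div_nat_cpow.2 hs)
    simpa using this
  have hz : HasSum (fun n : ℕ => 1 / ((n : ℂ) + 1) ^ s) (riemannZeta s) := by
    rw [zeta_eq_tsum_one_div_nat_add_one_cpow hs]; exact hsum.hasSum
  have hz1 : HasSum (fun n : ℕ => 1 / (((n + 1 : ℕ) : ℂ) + 1) ^ s) (riemannZeta s - 1) := by
    have := (hasSum_nat_add_iff' 1).2 hz
    simpa using this
  have hmain := (hz.add hz1).mul_left ((s - 1) / 2)
  have hsplit (n : ℕ) : trapezoidError (n + 1) s =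
      (s - 1) / 2 * (1 / ((n : ℂ) + 1) ^ s + 1 / (((n + 1 : ℕ) : ℂ) + 1) ^ s) +
        ((((n + 1 : ℕ) : ℂ) + 1) ^ (1 - s) - ((n : ℂ) + 1) ^ (1 - s)) := by
    simp only [trapezoidError, cpow_neg]
    push_cast
    simp only [one_div]
  have htele : HasSum (fun n : ℕ => (((n + 1 : ℕ) : ℂ) + 1) ^ (1 - s) - ((n : ℂ) + 1) ^ (1 - s))
      (-1) := by
    have h1 : Summable (fun n : ℕ => trapezoidError (n + 1) s) :=
      Summable.of_norm_bounded (summable_rpow_neg_five_fourths.mul_left _)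
        (norm_trapezoidError_nat_le (by linarith))
    have h2 : Summable (fun n : ℕ =>
        (((n + 1 : ℕ) : ℂ) + 1) ^ (1 - s) - ((n : ℂ) + 1) ^ (1 - s)) :=
      (h1.sub hmain.summable).congr fun n => by rw [hsplit n]; ring
    have h3 := h2.hasSum.tendsto_sum_nat
    simp only [Finset.sum_range_sub (fun n : ℕ => ((n : ℂ) + 1) ^ (1 - s))] at h3
    have h4 : Filter.Tendsto (fun n : ℕ => ((n : ℂ) + 1) ^ (1 - s)) Filter.atTop (nhds 0) := by
      rw [tendsto_zero_iff_norm_tendsto_zero]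
      have h5 := ((tendsto_rpow_neg_atTop (sub_pos.2 hs)).comp
        tendsto_natCast_atTop_atTop).comp (Filter.tendsto_add_atTop_nat 1)
      refine h5.congr fun n => ?_
      have := norm_natCast_cpow_of_pos (Nat.succ_pos n) (1 - s)
      push_cast at this
      simp only [Function.comp_apply, this]
      simp
    have h6 := tendsto_nhds_unique h3 (h4.sub_const _)
    rw [show (-1 : ℂ) = 0 - (((0 : ℕ) : ℂ) + 1) ^ (1 - s) by simp, ← h6]
    exact h2.hasSum
  have h := hmain.add htele
  rw [funext hsplit, show (s - 1) * (riemannZeta s - 1 / 2) - 1 =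
    (s - 1) / 2 * (riemannZeta s + (riemannZeta s - 1)) + -1 by ring]
  exact h

lemma entireZeta_eq_of_one_lt_re {s : ℂ} (hs : 1 < s.re) :
    entireZeta s = 1 + (s - 1) / 2 + ∑' n : ℕ, trapezoidError (n + 1) s := by
  have hs1 : s ≠ 1 := by rintro rfl; simp at hs
  rw [(hasSum_trapezoidError hs).tsum_eq, entireZeta_of_ne_one hs1]
  ring

lemma entireZeta_eq {s : ℂ} (hs : -(3 / 4) < s.re) :
    entireZeta s = 1 + (s - 1) / 2 + ∑' n : ℕ, trapezoidError (n + 1) s := by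
  set U : Set ℂ := {z | -(3 / 4) < z.re} with hU
  have hUo : IsOpen U := isOpen_lt continuous_const continuous_re
  have hUc : Convex ℝ U := convex_halfSpace_re_gt _
  have hd : DifferentiableOn ℂ (fun z => ∑' n : ℕ, trapezoidError (n + 1) z) U := by
    intro z hz
    set V : Set ℂ := U ∩ Metric.ball 0 (‖z‖ + 1)
    have hV : IsOpen V := hUo.inter Metric.isOpen_ball
    have : DifferentiableOn ℂ (fun z => ∑' n : ℕ, trapezoidError (n + 1) z) V := by
      refine differentiableOn_tsum_of_summable_norm
        (summable_rpow_neg_five_fourths.mul_left ((‖z‖ + 1 + 1) ^ 3))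
        (fun n => (differentiable_trapezoidError (by positivity)).differentiableOn) hV
        fun n w hw => ?_
      refine (norm_trapezoidError_nat_le hw.1.le n).trans ?_
      have : ‖w‖ ≤ ‖z‖ + 1 := (by simpa using hw.2 : ‖w‖ < ‖z‖ + 1).le
      gcongr
    exact ((this z ⟨hz, by simp⟩).differentiableAt (hV.mem_nhds ⟨hz, by simp⟩)).differentiableWithinAt
  have hg : AnalyticOnNhd ℂ (fun z => 1 + (z - 1) / 2 + ∑' n : ℕ, trapezoidError (n + 1) z) U :=
    DifferentiableOn.analyticOnNhd (by fun_prop) hUo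
  refine AnalyticOnNhd.eqOn_of_preconnected_of_eventuallyEq (fun z _ => analyticAt_entireZeta z) hg
    hUc.isPreconnected (z₀ := 2) (by simp [hU]; norm_num) ?_ hs
  filter_upwards [(isOpen_lt continuous_const continuous_re).mem_nhds
    (by simp : (2 : ℂ) ∈ {z : ℂ | 1 < z.re})] with z hz using entireZeta_eq_of_one_lt_re hz

lemma exists_norm_entireZeta_le :
    ∃ K : ℝ, 1 ≤ K ∧ ∀ s : ℂ, -(1 / 2) ≤ s.re → ‖entireZeta s‖ ≤ K * (‖s‖ + 1) ^ 3 := by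
  set S := ∑' n : ℕ, ((n : ℝ) + 1) ^ (-(5 / 4) : ℝ)
  have hS : 0 ≤ S := tsum_nonneg fun n => by positivity
  refine ⟨2 + S, by linarith, fun s hs => ?_⟩
  rw [entireZeta_eq (by linarith)]
  have h1 : ‖∑' n : ℕ, trapezoidError (n + 1) s‖ ≤ (‖s‖ + 1) ^ 3 * S :=
    tsum_of_norm_bounded (summable_rpow_neg_five_fourths.hasSum.mul_left _)
      (norm_trapezoidError_nat_le (by linarith))
  have h2 : ‖1 + (s - 1) / 2‖ ≤ ‖s‖ + 1 := by
    have : 1 + (s - 1) / 2 = s / 2 + 1 / 2 := by ring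
    rw [this]
    refine (norm_add_le _ _).trans ?_
    simp only [norm_div]; norm_num; linarith [norm_nonneg s]
  have h3 : ‖s‖ + 1 ≤ (‖s‖ + 1) ^ 3 := le_self_pow₀ (by linarith [norm_nonneg s]) (by norm_num)
  calc _ ≤ _ := norm_add_le _ _
    _ ≤ (‖s‖ + 1) ^ 3 + (‖s‖ + 1) ^ 3 * S := by linarith
    _ ≤ _ := by nlinarith [pow_nonneg (by positivity : 0 ≤ ‖s‖ + 1) 3]

lemma one_div_three_le_norm_entireZeta (t : ℝ) : 1 / 3 ≤ ‖entireZeta (2 + t * I)‖ := by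
  set s : ℂ := 2 + t * I with hs
  have hre : s.re = 2 := by simp [hs]
  have hs1 : s ≠ 1 := by intro h; rw [h] at hre; norm_num at hre
  have hz : HasSum (fun n : ℕ => 1 / (n : ℂ) ^ s) (riemannZeta s) := by
    rw [zeta_eq_tsum_one_div_nat_cpow (by linarith)]
    exact (Complex.summable_one_div_nat_cpow.2 (by linarith)).hasSum
  have h2 := (hasSum_nat_add_iff' 2).2 hz
  have h3 := (hasSum_nat_add_iff' 2).2 hasSum_zeta_two
  have hs0 : s ≠ 0 := by intro h; rw [h] at hre; norm_num at hre
  simp only [Finset.sum_range_succ, Finset.sum_range_zero] at h2 h3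
  norm_num [hs0] at h2 h3
  have h4 : ‖riemannZeta s - 1‖ ≤ Real.pi ^ 2 / 6 - 1 := by
    rw [← h2.tsum_eq]
    refine tsum_of_norm_bounded h3 fun n => ?_
    have := norm_natCast_cpow_of_pos (show 0 < n + 2 by omega) s
    push_cast at this
    rw [norm_inv, this, hre]
    norm_num
  have hpi : Real.pi ^ 2 / 6 - 1 ≤ 2 / 3 := by nlinarith [Real.pi_lt_d2, Real.pi_pos]
  have h5 : 1 / 3 ≤ ‖riemannZeta s‖ := by
    have := norm_sub_norm_le (1 : ℂ) (1 - riemannZeta s)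
    rw [sub_sub_cancel, norm_one, norm_sub_rev] at this
    linarith
  have h6 : 1 ≤ ‖s - 1‖ := by
    have := abs_re_le_norm (s - 1)
    rw [sub_re, hre] at this; norm_num at this; exact this
  rw [entireZeta_of_ne_one hs1, norm_mul]
  nlinarith [norm_nonneg (riemannZeta s)]

lemma analyticOrderAt_entireZeta_ne_top (ρ : ℂ) : analyticOrderAt entireZeta ρ ≠ ⊤ := by
  intro h
  have h0 := AnalyticOnNhd.eqOn_zero_of_preconnected_of_eventuallyEq_zero (U := Set.univ)
    (fun z _ => analyticAt_entireZeta z) isPreconnected_univ (Set.mem_univ ρ)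
    (analyticOrderAt_eq_top.1 h) (Set.mem_univ (2 + (0 : ℝ) * I))
  have h1 := one_div_three_le_norm_entireZeta 0
  rw [h0] at h1
  norm_num at h1

lemma zeroMult_riemannZeta_le {ρ : ℂ} (hρ : ρ ≠ 1) :
    zeroMult riemannZeta ρ ≤ analyticOrderNatAt entireZeta ρ := by
  refine csSup_le' ?_
  rintro n ⟨g, hg, hgz⟩
  have h : (n : ℕ∞) ≤ analyticOrderAt entireZeta ρ := by
    refine (natCast_le_analyticOrderAt (analyticAt_entireZeta ρ)).2
      ⟨fun z => (z - 1) * g z, (analyticAt_id.sub analyticAt_const).mul hg, ?_⟩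
    filter_upwards [hgz, isOpen_ne.mem_nhds hρ] with z hz hz1
    rw [entireZeta_of_ne_one hz1, hz, smul_eq_mul]
    ring
  rw [← Nat.cast_analyticOrderNatAt (analyticOrderAt_entireZeta_ne_top ρ)] at h
  exact_mod_cast h

lemma sum_zeroMult_le_finsum_divisor {c : ℂ} {r : ℝ} (s : Finset ℂ)
    (hs : ∀ ρ ∈ s, ρ ≠ 1 ∧ ρ ∈ Metric.closedBall c r) :
    ((∑ ρ ∈ s, zeroMult riemannZeta ρ : ℕ) : ℤ) ≤
      ∑ᶠ u, MeromorphicOn.divisor entireZeta (Metric.closedBall c r) u := by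
  have han : AnalyticOnNhd ℂ entireZeta (Metric.closedBall c r) :=
    fun z _ => analyticAt_entireZeta z
  set D := MeromorphicOn.divisor entireZeta (Metric.closedBall c r) with hD
  have hfin : D.support.Finite := D.finiteSupport (isCompact_closedBall c r)
  rw [finsum_eq_sum_of_support_subset (s := s ∪ hfin.toFinset) _ (by simp)]
  push_cast
  calc ∑ ρ ∈ s, (zeroMult riemannZeta ρ : ℤ) ≤ ∑ ρ ∈ s, D ρ := by
        refine Finset.sum_le_sum fun ρ hρ => ?_
        rw [hD, MeromorphicOn.AnalyticOnNhd.divisor_apply han (hs ρ hρ).2]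
        have h1 := zeroMult_riemannZeta_le (hs ρ hρ).1
        have h2 := Nat.cast_analyticOrderNatAt (analyticOrderAt_entireZeta_ne_top ρ)
        rw [← h2]
        simpa using h1
    _ ≤ _ := Finset.sum_le_sum_of_subset_of_nonneg Finset.subset_union_left
        fun ρ _ _ => MeromorphicOn.AnalyticOnNhd.divisor_nonneg han ρ

lemma exists_sum_zeroMult_le_log :
    ∃ A : ℝ, 0 ≤ A ∧ ∀ T t : ℝ, 2 ≤ T → 0 ≤ t → t ≤ T + 1 → ∀ s : Finset ℂ,
      (∀ ρ ∈ s, 0 < ρ.re ∧ ρ.re < 1 ∧ |ρ.im - t| ≤ 1 / 2) →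
      ∑ ρ ∈ s, (zeroMult riemannZeta ρ : ℝ) ≤ A * Real.log T := by
  obtain ⟨K, hK1, hK⟩ := exists_norm_entireZeta_le
  have hl : 0 < Real.log ((5 / 2) / (21 / 10)) := Real.log_pos (by norm_num)
  have hl2 : 0 < Real.log 2 := Real.log_pos (by norm_num)
  have hlK : 0 ≤ Real.log (375 * K) := Real.log_nonneg (by linarith)
  refine ⟨(Real.log (375 * K) / Real.log 2 + 3) / Real.log ((5 / 2) / (21 / 10)), by positivity,
    fun T t hT ht htT s hs => ?_⟩
  set c : ℂ := 2 + t * I with hc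
  have hcre : c.re = 2 := by simp [hc]
  have hcim : c.im = t := by simp [hc]
  have hball : ∀ ρ ∈ s, ρ ≠ 1 ∧ ρ ∈ Metric.closedBall c |(21 / 10 : ℝ)| := by
    intro ρ hρ
    obtain ⟨h1, h2, h3⟩ := hs ρ hρ
    refine ⟨by rintro rfl; simp at h2, ?_⟩
    rw [Metric.mem_closedBall, dist_eq_norm, abs_of_pos (by norm_num),
      Complex.norm_eq_sqrt_sq_add_sq, Real.sqrt_le_left (by norm_num), sub_re, sub_im, hcre, hcim]
    have := abs_le.1 h3
    nlinarith
  have hM : 1 ≤ K * (5 * T) ^ 3 := by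
    have : 1 ≤ (5 * T) ^ 3 := one_le_pow₀ (by linarith)
    nlinarith
  have hc3 := one_div_three_le_norm_entireZeta t
  rw [← hc] at hc3
  have hJ := AnalyticOnNhd.sum_divisor_le (c := c) (r := 21 / 10) (R := 5 / 2)
    (M := K * (5 * T) ^ 3) (f := entireZeta) (by norm_num)
    (by rw [abs_of_pos, abs_of_pos] <;> norm_num) hM (fun z _ => analyticAt_entireZeta z)
    (by intro h; rw [h] at hc3; norm_num at hc3) (by
      intro z hz
      rw [mem_sphere_iff_norm, abs_of_pos (by norm_num)] at hz
      have h1 := abs_re_le_norm (z - c)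
      rw [hz, sub_re, hcre] at h1
      have h2 : ‖z‖ ≤ 5 / 2 + (2 + t) := by
        calc ‖z‖ = ‖(z - c) + c‖ := by rw [sub_add_cancel]
          _ ≤ ‖z - c‖ + ‖c‖ := norm_add_le _ _
          _ ≤ 5 / 2 + (2 + t) := by
            rw [hz]
            gcongr
            refine (norm_add_le _ _).trans ?_
            simp [abs_of_nonneg ht]
      refine (hK z (by linarith [(abs_le.1 h1).1])).trans ?_
      gcongr
      linarith)
  have hs' := sum_zeroMult_le_finsum_divisor s hball
  have hs'' : ∑ ρ ∈ s, (zeroMult riemannZeta ρ : ℝ) ≤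
      ((∑ᶠ u, MeromorphicOn.divisor entireZeta (Metric.closedBall c |(21 / 10 : ℝ)|) u : ℤ) : ℝ) := by
    exact_mod_cast hs'
  refine hs''.trans (hJ.trans ?_)
  rw [div_mul_eq_mul_div]
  gcongr
  calc Real.log (K * (5 * T) ^ 3 / ‖entireZeta c‖)
      ≤ Real.log (K * (5 * T) ^ 3 / (1 / 3)) := by gcongr
    _ = Real.log (375 * K) + 3 * Real.log T := by
      rw [show K * (5 * T) ^ 3 / (1 / 3) = (375 * K) * T ^ 3 by ring,
        Real.log_mul (by positivity) (by positivity), Real.log_pow]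
      norm_num
    _ ≤ (Real.log (375 * K) / Real.log 2 + 3) * Real.log T := by
      rw [add_mul, div_mul_eq_mul_div]
      gcongr
      rw [le_div_iff₀ hl2]
      gcongr

lemma summable_one_div_one_add_int_sq : Summable (fun n : ℤ => 1 / (1 + (n : ℝ) ^ 2)) := by
  refine Summable.of_norm_bounded_eventually (Real.summable_one_div_int_pow.2 one_lt_two) ?_
  refine (Set.finite_singleton (0 : ℤ)).subset fun n hn => ?_
  by_contra h
  have h0 : (n : ℝ) ≠ 0 := by exact_mod_cast h
  refine hn ?_
  change ‖1 / (1 + (n : ℝ) ^ 2)‖ ≤ 1 / (n : ℝ) ^ 2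
  rw [Real.norm_of_nonneg (by positivity)]
  gcongr
  linarith

lemma sum_div_one_add_sq_le {ι : Type*} (s : Finset ι) (m γ : ι → ℝ) (hm : ∀ i ∈ s, 0 ≤ m i)
    (hγ : ∀ i ∈ s, 0 ≤ γ i) {L : ℝ} (hL : ∀ k : ℕ, ∑ i ∈ s with ⌊γ i⌋₊ = k, m i ≤ L) {x : ℝ}
    (hx : 0 ≤ x) :
    ∑ i ∈ s, m i * (1 / (1 + (x - γ i) ^ 2)) ≤ 3 * (∑' n : ℤ, 1 / (1 + (n : ℝ) ^ 2)) * L := by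
  have hL0 : 0 ≤ L := le_trans
    (Finset.sum_nonneg fun i hi => hm i (Finset.mem_filter.1 hi).1) (hL 0)
  rw [← Finset.sum_fiberwise_of_maps_to (g := fun i => ⌊γ i⌋₊) (t := s.image fun i => ⌊γ i⌋₊)
    (fun i hi => Finset.mem_image_of_mem _ hi)]
  have hfib (k : ℕ) : ∑ i ∈ s with ⌊γ i⌋₊ = k, m i * (1 / (1 + (x - γ i) ^ 2)) ≤
      3 * (1 / (1 + (((⌊x⌋₊ : ℤ) - (k : ℤ) : ℤ) : ℝ) ^ 2)) * L := by
    calc _ ≤ ∑ i ∈ s with ⌊γ i⌋₊ = k, m i * (3 * (1 / (1 + (((⌊x⌋₊ : ℤ) - (k : ℤ) : ℤ) : ℝ) ^ 2))) := by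
          refine Finset.sum_le_sum fun i hi => ?_
          obtain ⟨his, hik⟩ := Finset.mem_filter.1 hi
          refine mul_le_mul_of_nonneg_left ?_ (hm i his)
          rw [mul_one_div, div_le_div_iff₀ (by positivity) (by positivity)]
          have h1 := Nat.floor_le (hγ i his)
          have h2 := Nat.lt_floor_add_one (γ i)
          have h3 := Nat.floor_le hx
          have h4 := Nat.lt_floor_add_one x
          rw [hik] at h1 h2
          push_cast
          set D : ℝ := (⌊x⌋₊ : ℝ) - k
          have h5 : |D - (x - γ i)| ≤ 1 := abs_le.2 ⟨by simp only [D]; linarith, by simp only [D]; linarith⟩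
          have h6 := sq_le_one_iff_abs_le_one _ |>.2 h5
          nlinarith [sq_nonneg (D - 2 * (x - γ i))]
      _ = 3 * (1 / (1 + (((⌊x⌋₊ : ℤ) - (k : ℤ) : ℤ) : ℝ) ^ 2)) * ∑ i ∈ s with ⌊γ i⌋₊ = k, m i := by
          rw [← Finset.sum_mul, mul_comm]
      _ ≤ _ := mul_le_mul_of_nonneg_left (hL k) (by positivity)
  refine (Finset.sum_le_sum fun k _ => hfib k).trans ?_
  rw [← Finset.sum_mul, ← Finset.mul_sum]
  gcongr
  have hinj : Function.Injective fun k : ℕ => (⌊x⌋₊ : ℤ) - (k : ℤ) := fun a b h => by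
    simpa using h
  rw [← Finset.sum_image (s := s.image fun i => ⌊γ i⌋₊)
    (f := fun n : ℤ => 1 / (1 + (n : ℝ) ^ 2)) hinj.injOn]
  exact summable_one_div_one_add_int_sq.sum_le_tsum _ fun n _ => by positivity

lemma integral_gaussian_mul_exp {V : ℝ} (hV : 0 < V) (t : ℝ) :
    ‖∫ ξ : ℝ, cexp (I * (2 * Real.pi * t : ℝ) * ξ) * cexp (-((1 / V ^ 2 : ℝ) : ℂ) * ξ ^ 2)‖ =
      Real.sqrt Real.pi * V * Real.exp (-(Real.pi * V * t) ^ 2) := by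
  have hb : 0 < ((1 / V ^ 2 : ℝ) : ℂ).re := by rw [ofReal_re]; positivity
  rw [fourierIntegral_gaussian hb, norm_mul]
  congr 1
  · rw [← ofReal_div, norm_cpow_eq_rpow_re_of_pos (by positivity)]
    rw [show ((1 / 2 : ℂ)).re = 1 / 2 by simp, ← Real.sqrt_eq_rpow, div_div_eq_mul_div, div_one,
      Real.sqrt_mul Real.pi_pos.le, Real.sqrt_sq hV.le]
  · rw [Complex.norm_exp]
    congr 1
    rw [show (-((2 * Real.pi * t : ℝ) : ℂ) ^ 2 / (4 * ((1 / V ^ 2 : ℝ) : ℂ))) =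
      ((-(2 * Real.pi * t) ^ 2 / (4 * (1 / V ^ 2)) : ℝ) : ℂ) by push_cast; rfl, ofReal_re]
    field_simp
    ring

lemma integral_gaussian_mul_norm_sq_le {ι : Type*} (s : Finset ι) (m γ : ι → ℝ)
    (hm : ∀ i ∈ s, 0 ≤ m i) {V : ℝ} (hV : 0 < V) :
    ∫ ξ : ℝ, Real.exp (-(1 / V ^ 2) * ξ ^ 2) *
        ‖∑ i ∈ s, (m i : ℂ) * cexp (2 * Real.pi * I * γ i * ξ)‖ ^ 2 ≤
      Real.sqrt Real.pi * V *
        ∑ i ∈ s, m i * ∑ j ∈ s, m j * Real.exp (-(Real.pi * V * (γ i - γ j)) ^ 2) := by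
  have hb : 0 < ((1 / V ^ 2 : ℝ) : ℂ).re := by rw [ofReal_re]; positivity
  have hexp (ξ : ℝ) : ((Real.exp (-(1 / V ^ 2) * ξ ^ 2) *
        ‖∑ i ∈ s, (m i : ℂ) * cexp (2 * Real.pi * I * γ i * ξ)‖ ^ 2 : ℝ) : ℂ) =
      ∑ i ∈ s, ∑ j ∈ s, (m i * m j : ℂ) * (cexp (I * (2 * Real.pi * (γ i - γ j) : ℝ) * ξ) *
        cexp (-((1 / V ^ 2 : ℝ) : ℂ) * ξ ^ 2)) := by
    push_cast
    rw [← Complex.mul_conj', map_sum, Finset.sum_mul_sum, Finset.mul_sum]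
    refine Finset.sum_congr rfl fun i _ => ?_
    rw [Finset.mul_sum]
    refine Finset.sum_congr rfl fun j _ => ?_
    rw [map_mul, conj_ofReal, ← exp_conj]
    simp only [map_mul, conj_ofReal, conj_I, Complex.conj_ofNat]
    have : I * (2 * (Real.pi : ℂ) * (γ i - γ j)) * ξ =
      2 * Real.pi * I * γ i * ξ + 2 * Real.pi * -I * γ j * ξ := by ring
    rw [this, Complex.exp_add]
    ring
  have hint (i j : ι) : Integrable (fun ξ : ℝ =>
      (m i * m j : ℂ) * (cexp (I * (2 * Real.pi * (γ i - γ j) : ℝ) * ξ) *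
        cexp (-((1 / V ^ 2 : ℝ) : ℂ) * ξ ^ 2))) := by
    refine Integrable.const_mul ?_ _
    refine (integrable_cexp_quadratic hb (I * (2 * Real.pi * (γ i - γ j) : ℝ)) 0).congr
      (Filter.Eventually.of_forall fun ξ => ?_)
    simp only [add_zero]
    rw [← Complex.exp_add, add_comm]
  refine (le_abs_self _).trans ?_
  rw [← Real.norm_eq_abs, ← Complex.norm_real, ← integral_complex_ofReal]
  simp only [hexp]
  rw [integral_finsetSum _ fun i _ => integrable_finsetSum _ fun j _ => hint i j, Finset.mul_sum]
  refine norm_sum_le_of_le _ fun i hi => ?_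
  rw [integral_finsetSum _ fun j _ => hint i j, Finset.mul_sum, Finset.mul_sum]
  refine norm_sum_le_of_le _ fun j hj => ?_
  rw [integral_const_mul, norm_mul, integral_gaussian_mul_exp hV, norm_mul, Complex.norm_real,
    Complex.norm_real, Real.norm_of_nonneg (hm i hi), Real.norm_of_nonneg (hm j hj)]
  apply le_of_eq
  ring

lemma exists_finset_Qzeta_eq (T : ℝ) : ∃ s : Finset ℂ, (∀ ρ ∈ s, inZeroBox ρ T) ∧
    ∀ ξ : ℝ, Qzeta ξ T = ∑ ρ ∈ s,
      (((zeroMult riemannZeta ρ : ℕ) : ℝ) : ℂ) * cexp (2 * Real.pi * I * ρ.im * ξ) := by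
  have hfin : ({ρ : ℂ | inZeroBox ρ T} ∩ riemannZetaZeros).Finite := by
    refine ((isCompact_Icc.reProdIm isCompact_Icc :
      IsCompact (Set.Icc (0 : ℝ) 1 ×ℂ Set.Icc (0 : ℝ) T)).inter_riemannZetaZeros_finite).subset ?_
    rintro ρ ⟨⟨h1, h2, h3, h4⟩, h5⟩
    exact ⟨⟨⟨h1.le, h2.le⟩, ⟨h3.le, h4⟩⟩, h5⟩
  refine ⟨hfin.toFinset, fun ρ hρ => (hfin.mem_toFinset.1 hρ).1, fun ξ => ?_⟩
  unfold Qzeta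
  rw [tsum_eq_sum (s := hfin.toFinset)]
  · refine Finset.sum_congr rfl fun ρ hρ => ?_
    have hbox : inZeroBox ρ T := (hfin.mem_toFinset.1 hρ).1
    rw [if_pos hbox]
    simp
  · intro ρ hρ
    split_ifs with hbox
    · have hne : ρ ≠ 1 := by rintro rfl; simpa using hbox.2.1
      have hz : riemannZeta ρ ≠ 0 := fun h => hρ (hfin.mem_toFinset.2 ⟨hbox, h⟩)
      have h0 := zeroMult_riemannZeta_le hne
      have h1 : analyticOrderAt entireZeta ρ = 0 := by
        rw [(analyticAt_entireZeta ρ).analyticOrderAt_eq_zero, entireZeta_of_ne_one hne]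
        exact mul_ne_zero (sub_ne_zero.2 hne) hz
      rw [analyticOrderNatAt, h1] at h0
      simp at h0
      simp [h0]
    · rfl

lemma exists_integral_gaussian_mul_Qzeta_le : ∃ B : ℝ, 0 ≤ B ∧ ∀ T V : ℝ, 2 ≤ T → 1 ≤ V →
    ∫ ξ : ℝ, Real.exp (-(1 / V ^ 2) * ξ ^ 2) * ‖Qzeta ξ T‖ ^ 2 ≤
      B * (T * Real.log T ^ 2) * V := by
  obtain ⟨A, hA0, hA⟩ := exists_sum_zeroMult_le_log
  set S := ∑' n : ℤ, 1 / (1 + (n : ℝ) ^ 2)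
  have hS : 0 ≤ S := tsum_nonneg fun n => by positivity
  refine ⟨Real.sqrt Real.pi * (2 * A * (3 * S * A)), by positivity, fun T V hT hV => ?_⟩
  have hlT : 0 ≤ Real.log T := Real.log_nonneg (by linarith)
  obtain ⟨s, hs, hQ⟩ := exists_finset_Qzeta_eq T
  set m : ℂ → ℝ := fun ρ => ((zeroMult riemannZeta ρ : ℕ) : ℝ) with hm
  set L := A * Real.log T with hL
  have hL0 : 0 ≤ L := by positivity
  have hwin (k : ℕ) : ∑ ρ ∈ s with ⌊ρ.im⌋₊ = k, m ρ ≤ L := by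
    by_cases hk : (k : ℝ) ≤ T
    · refine hA T (k + 1 / 2) hT (by positivity) (by linarith) _ fun ρ hρ => ?_
      obtain ⟨h1, h2⟩ := Finset.mem_filter.1 hρ
      obtain ⟨h3, h4, h5, h6⟩ := hs ρ h1
      have h7 := Nat.floor_le h5.le
      have h8 := Nat.lt_floor_add_one ρ.im
      rw [h2] at h7 h8
      exact ⟨h3, h4, abs_le.2 ⟨by linarith, by linarith⟩⟩
    · rw [Finset.filter_false_of_mem, Finset.sum_empty]
      · exact hL0
      · rintro ρ hρ rfl
        exact hk ((Nat.floor_le (hs ρ hρ).2.2.1.le).trans (hs ρ hρ).2.2.2)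
  have htot : ∑ ρ ∈ s, m ρ ≤ 2 * T * L := by
    rw [← Finset.sum_fiberwise_of_maps_to (g := fun ρ => ⌊ρ.im⌋₊)
      (t := Finset.range (⌊T⌋₊ + 1)) (fun ρ hρ => by
        have := Nat.floor_le_floor (hs ρ hρ).2.2.2
        simp only [Finset.mem_range]; omega)]
    refine (Finset.sum_le_sum fun k _ => hwin k).trans ?_
    rw [Finset.sum_const, Finset.card_range, nsmul_eq_mul]
    gcongr
    have := Nat.floor_le (by linarith : 0 ≤ T)
    push_cast
    linarith
  simp only [hQ]
  refine (integral_gaussian_mul_norm_sq_le s m (fun ρ => ρ.im) (fun _ _ => by positivity)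
    (by positivity)).trans ?_
  have hinner (ρ : ℂ) (hρ : ρ ∈ s) :
      ∑ ρ' ∈ s, m ρ' * Real.exp (-(Real.pi * V * (ρ.im - ρ'.im)) ^ 2) ≤ 3 * S * L := by
    refine le_trans (Finset.sum_le_sum fun ρ' _ => ?_)
      (sum_div_one_add_sq_le s m (fun ρ => ρ.im) (fun _ _ => by positivity)
        (fun ρ hρ => (hs ρ hρ).2.2.1.le) hwin (hs ρ hρ).2.2.1.le)
    refine mul_le_mul_of_nonneg_left ?_ (by positivity)
    set x := ρ.im - ρ'.im
    rw [Real.exp_neg, ← one_div]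
    refine one_div_le_one_div_of_le (by positivity) ?_
    have h1 := Real.add_one_le_exp ((Real.pi * V * x) ^ 2)
    have h2 : 1 ≤ (Real.pi * V) ^ 2 :=
      one_le_pow₀ (one_le_mul_of_one_le_of_one_le (by linarith [Real.pi_gt_three]) hV)
    have h3 : x ^ 2 ≤ (Real.pi * V * x) ^ 2 := by
      rw [mul_pow]; exact le_mul_of_one_le_left (sq_nonneg x) h2
    linarith
  calc _ ≤ Real.sqrt Real.pi * V * ∑ ρ ∈ s, m ρ * (3 * S * L) := by
        gcongr with ρ hρ
        exact hinner ρ hρ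
    _ = Real.sqrt Real.pi * V * ((∑ ρ ∈ s, m ρ) * (3 * S * L)) := by rw [Finset.sum_mul]
    _ ≤ Real.sqrt Real.pi * V * ((2 * T * L) * (3 * S * L)) := by gcongr
    _ = _ := by rw [hL]; ring

lemma FT_eq_fourier (h : ℝ → ℂ) : FT h = FourierTransform.fourier h := by
  ext ξ
  rw [Real.fourier_real_eq_integral_exp_smul, FT]
  congr 1 with x
  rw [smul_eq_mul, mul_comm]
  congr 2
  push_cast
  ring

lemma MemH.exists_norm_FT_le {h : ℝ → ℂ} (hh : MemH h) :
    ∃ C : ℝ, 0 ≤ C ∧ ∀ ξ : ℝ, 1 ≤ ξ → ‖FT h ξ‖ ≤ C / ξ ^ 4 := by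
  obtain ⟨C, hC⟩ := hh.ft_deriv_decay
  have hC0 : 0 ≤ C := by
    have := (norm_nonneg _).trans (hC 1 (by simp))
    simpa using this
  have hd : Differentiable ℝ (FT h) := by
    rw [FT_eq_fourier]
    have hx : Integrable (fun x : ℝ => x • h x) := by simpa using hh.xh_integrable
    exact fun ξ => (Real.hasDerivAt_fourier hh.integrable hx ξ).differentiableAt
  have hlim : Filter.Tendsto (FT h) Filter.atTop (nhds 0) := by
    rw [FT_eq_fourier]
    exact (Real.zero_at_infty_fourier h).mono_left atTop_le_cocompact
  refine ⟨C / 4, by positivity, fun ξ hξ => ?_⟩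
  have hbound : ∀ X, ξ ≤ X → ‖FT h X - FT h ξ‖ ≤ C / 4 / ξ ^ 4 := by
    intro X hX
    have hB (x : ℝ) (hx : 0 < x) :
        HasDerivAt (fun y : ℝ => C / 4 * (ξ ^ (-4 : ℝ) - y ^ (-4 : ℝ))) (C * x ^ (-5 : ℝ)) x := by
      refine (((Real.hasDerivAt_rpow_const (Or.inl hx.ne')).const_sub _).const_mul _).congr_deriv ?_
      norm_num
      ring
    have := image_norm_le_of_norm_deriv_right_le_deriv_boundary'
      (f := fun y => FT h y - FT h ξ) (f' := deriv (FT h)) (a := ξ) (b := X)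
      (B := fun y : ℝ => C / 4 * (ξ ^ (-4 : ℝ) - y ^ (-4 : ℝ))) (B' := fun x => C * x ^ (-5 : ℝ))
      (hd.continuous.sub continuous_const).continuousOn
      (fun x _ => ((hd x).hasDerivAt.sub_const _).hasDerivWithinAt) (by simp)
      (fun x hx => (hB x (by linarith [hx.1])).continuousAt.continuousWithinAt)
      (fun x hx => (hB x (by linarith [hx.1])).hasDerivWithinAt)
      (fun x hx => by
        have h0 : 0 ≤ x := by linarith [hx.1]
        have := hC x (by rw [abs_of_nonneg h0]; linarith [hx.1])
        rwa [abs_of_nonneg h0] at this)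
      (⟨hX, le_rfl⟩ : X ∈ Set.Icc ξ X)
    refine this.trans ?_
    have h4 : ξ ^ (-4 : ℝ) = 1 / ξ ^ 4 := by
      rw [Real.rpow_neg (by linarith), one_div]; norm_cast
    rw [h4, div_eq_mul_one_div (C / 4)]
    gcongr
    have : 0 ≤ X ^ (-4 : ℝ) := Real.rpow_nonneg (by linarith) _
    linarith
  have h1 : Filter.Tendsto (fun X => ‖FT h X - FT h ξ‖) Filter.atTop (nhds ‖FT h ξ‖) := by
    simpa using (hlim.sub_const (FT h ξ)).norm
  exact le_of_tendsto h1 (Filter.eventually_atTop.2 ⟨ξ, hbound⟩)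

lemma Ioi_subset_iUnion_Ico_two_pow {U : ℝ} (hU : 0 < U) :
    Set.Ioi U ⊆ ⋃ k : ℕ, Set.Ico (2 ^ k * U) (2 ^ (k + 1) * U) := by
  intro ξ hξ
  obtain ⟨n, h1, h2⟩ := exists_nat_pow_near (x := ξ / U) ((one_le_div hU).2 (le_of_lt hξ))
    (one_lt_two : (1 : ℝ) < 2)
  refine Set.mem_iUnion.2 ⟨n, ?_, ?_⟩
  · rwa [le_div_iff₀ hU] at h1
  · rwa [div_lt_iff₀ hU] at h2

/-- If Gaussian averages of `q ≥ 0` at scale `V` are at most `B * V`, then the tail of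
`q ξ / ξ ^ 4` beyond `U` is `O(B / U ^ 3)`. -/
lemma lintegral_Ioi_div_pow_four_le {q : ℝ → ℝ} (hq0 : ∀ ξ, 0 ≤ q ξ) {B : ℝ} (hB : 0 ≤ B)
    (hint : ∀ V : ℝ, 1 ≤ V → Integrable fun ξ => Real.exp (-(1 / V ^ 2) * ξ ^ 2) * q ξ)
    (hq : ∀ V : ℝ, 1 ≤ V → ∫ ξ, Real.exp (-(1 / V ^ 2) * ξ ^ 2) * q ξ ≤ B * V)
    {U : ℝ} (hU : 1 ≤ U) :
    ∫⁻ ξ in Set.Ioi U, ENNReal.ofReal (q ξ / ξ ^ 4) ≤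
      ENNReal.ofReal (4 * Real.exp 1 * B / U ^ 3) := by
  have hpiece (k : ℕ) : ∫⁻ ξ in Set.Ico (2 ^ k * U) (2 ^ (k + 1) * U),
      ENNReal.ofReal (q ξ / ξ ^ 4) ≤
        ENNReal.ofReal (2 * Real.exp 1 * B / U ^ 3 * (1 / 2) ^ k) := by
    set V := 2 ^ (k + 1) * U with hV
    have hk1 : (1 : ℝ) ≤ 2 ^ k := one_le_pow₀ one_le_two
    have hV1 : 1 ≤ V := one_le_mul_of_one_le_of_one_le (one_le_pow₀ one_le_two) hU
    set a : ℝ := Real.exp 1 / (2 ^ k * U) ^ 4 with ha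
    have ha0 : 0 ≤ a := by positivity
    calc _ ≤ ∫⁻ ξ in Set.Ico (2 ^ k * U) V,
          ENNReal.ofReal (a * (Real.exp (-(1 / V ^ 2) * ξ ^ 2) * q ξ)) := by
          refine setLIntegral_mono' measurableSet_Ico fun ξ hξ => ENNReal.ofReal_le_ofReal ?_
          have hξ0 : 0 < 2 ^ k * U := by positivity
          have h1 : 1 ≤ Real.exp 1 * Real.exp (-(1 / V ^ 2) * ξ ^ 2) := by
            rw [← Real.exp_add]
            refine Real.one_le_exp ?_
            have : ξ ^ 2 / V ^ 2 ≤ 1 :=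
              div_le_one_of_le₀ (pow_le_pow_left₀ (hξ0.trans_le hξ.1).le hξ.2.le 2) (by positivity)
            rw [neg_mul, one_div_mul_eq_div]; linarith
          calc q ξ / ξ ^ 4 ≤ q ξ / (2 ^ k * U) ^ 4 := by
                have := hq0 ξ
                have := hξ.1
                gcongr
            _ ≤ (Real.exp 1 * Real.exp (-(1 / V ^ 2) * ξ ^ 2)) * (q ξ / (2 ^ k * U) ^ 4) :=
                le_mul_of_one_le_left (div_nonneg (hq0 ξ) (by positivity)) h1
            _ = _ := by rw [ha]; ring
      _ ≤ ∫⁻ ξ, ENNReal.ofReal (a * (Real.exp (-(1 / V ^ 2) * ξ ^ 2) * q ξ)) :=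
          setLIntegral_le_lintegral _ _
      _ = ENNReal.ofReal (a * ∫ ξ, Real.exp (-(1 / V ^ 2) * ξ ^ 2) * q ξ) := by
          rw [← integral_const_mul, ofReal_integral_eq_lintegral_ofReal ((hint V hV1).const_mul a)]
          exact Filter.Eventually.of_forall fun ξ =>
            mul_nonneg ha0 (mul_nonneg (Real.exp_nonneg _) (hq0 ξ))
      _ ≤ _ := by
          refine ENNReal.ofReal_le_ofReal ?_
          calc _ ≤ a * (B * V) := mul_le_mul_of_nonneg_left (hq V hV1) ha0
            _ = 2 * Real.exp 1 * B / U ^ 3 * (1 / (2 ^ k) ^ 3) := by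
              rw [ha, hV]; field_simp; ring
            _ ≤ _ := by
              rw [one_div_pow]
              gcongr
              exact le_self_pow₀ hk1 (by norm_num)
  calc _ ≤ ∫⁻ ξ in ⋃ k : ℕ, Set.Ico (2 ^ k * U) (2 ^ (k + 1) * U),
        ENNReal.ofReal (q ξ / ξ ^ 4) :=
        lintegral_mono_set (Ioi_subset_iUnion_Ico_two_pow (by linarith))
    _ ≤ ∑' k : ℕ, ∫⁻ ξ in Set.Ico (2 ^ k * U) (2 ^ (k + 1) * U), ENNReal.ofReal (q ξ / ξ ^ 4) :=
        lintegral_iUnion_le _ _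
    _ ≤ ∑' k : ℕ, ENNReal.ofReal (2 * Real.exp 1 * B / U ^ 3 * (1 / 2) ^ k) :=
        ENNReal.tsum_le_tsum hpiece
    _ = ENNReal.ofReal (4 * Real.exp 1 * B / U ^ 3) := by
        rw [← ENNReal.ofReal_tsum_of_nonneg (fun k => by positivity)
          (summable_geometric_two.mul_left _), tsum_mul_left, tsum_geometric_two]
        congr 1
        ring

lemma integrable_gaussian_mul_Qzeta (T : ℝ) {V : ℝ} (hV : 0 < V) :
    Integrable fun ξ => Real.exp (-(1 / V ^ 2) * ξ ^ 2) * ‖Qzeta ξ T‖ ^ 2 := by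
  obtain ⟨s, -, hQ⟩ := exists_finset_Qzeta_eq T
  have hbd (ξ : ℝ) : ‖Qzeta ξ T‖ ≤ ∑ ρ ∈ s, (zeroMult riemannZeta ρ : ℝ) := by
    rw [hQ]
    refine norm_sum_le_of_le _ fun ρ _ => ?_
    rw [norm_mul, show 2 * (Real.pi : ℂ) * I * ρ.im * ξ = ((2 * Real.pi * ρ.im * ξ : ℝ) : ℂ) * I by
      push_cast; ring, Complex.norm_exp_ofReal_mul_I, mul_one, Complex.norm_real]
    simp
  have hcont : Continuous fun ξ => Qzeta ξ T := by
    simp only [hQ]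
    fun_prop
  refine (integrable_exp_neg_mul_sq (by positivity : 0 < 1 / V ^ 2)).mul_bdd
    (c := (∑ ρ ∈ s, (zeroMult riemannZeta ρ : ℝ)) ^ 2)
    (hcont.norm.pow 2).aestronglyMeasurable (Filter.Eventually.of_forall fun ξ => ?_)
  rw [norm_pow, norm_norm]
  exact pow_le_pow_left₀ (norm_nonneg _) (hbd ξ) 2

/-- For `h ∈ H`, `|∫_U^∞ ĥ(ξ)|Q(ξ;T)|² dξ| ≪_h T(log T)³/U⁴ + T(log T)²/U³`
for all `U ≥ 1`, `T ≥ 2`. -/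
theorem tail_integral_bound (h : ℝ → ℂ) (hh : MemH h) :
    ∃ C : ℝ, ∀ U T : ℝ, 1 ≤ U → 2 ≤ T →
      ‖∫ ξ in Set.Ioi U, FT h ξ * ((‖Qzeta ξ T‖ : ℂ) ^ 2)‖ ≤
        C * (T * Real.log T ^ 3 / U ^ 4 + T * Real.log T ^ 2 / U ^ 3) := by
  obtain ⟨C, hC0, hC⟩ := hh.exists_norm_FT_le
  obtain ⟨B, hB0, hB⟩ := exists_integral_gaussian_mul_Qzeta_le
  refine ⟨C * (4 * Real.exp 1 * B), fun U T hU hT => ?_⟩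
  have hlT : 0 ≤ Real.log T := Real.log_nonneg (by linarith)
  have hTL : 0 ≤ B * (T * Real.log T ^ 2) := by positivity
  have htail := lintegral_Ioi_div_pow_four_le (q := fun ξ => ‖Qzeta ξ T‖ ^ 2)
    (fun ξ => by positivity) hTL
    (fun V hV => integrable_gaussian_mul_Qzeta T (by linarith)) (fun V hV => hB T V hT hV) hU
  have hpt : ∫⁻ ξ in Set.Ioi U, ‖FT h ξ * ((‖Qzeta ξ T‖ : ℂ) ^ 2)‖ₑ ≤
      ENNReal.ofReal C * ∫⁻ ξ in Set.Ioi U, ENNReal.ofReal (‖Qzeta ξ T‖ ^ 2 / ξ ^ 4) := by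
    rw [← lintegral_const_mul' _ _ ENNReal.ofReal_ne_top]
    refine setLIntegral_mono' measurableSet_Ioi fun ξ hξ => ?_
    rw [← ENNReal.ofReal_mul hC0, ← ofReal_norm]
    refine ENNReal.ofReal_le_ofReal ?_
    rw [norm_mul, norm_pow, Complex.norm_real, norm_norm, ← mul_div_assoc, mul_div_right_comm]
    gcongr
    exact hC ξ (hU.trans (le_of_lt hξ))
  have hle : ‖∫ ξ in Set.Ioi U, FT h ξ * ((‖Qzeta ξ T‖ : ℂ) ^ 2)‖ ≤
      C * (4 * Real.exp 1 * (B * (T * Real.log T ^ 2)) / U ^ 3) := by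
    rw [← ENNReal.ofReal_le_ofReal_iff (by positivity), ofReal_norm]
    refine (enorm_integral_le_lintegral_enorm _).trans (hpt.trans ?_)
    rw [ENNReal.ofReal_mul hC0]
    gcongr
  have hextra : 0 ≤ C * (4 * Real.exp 1 * B) * (T * Real.log T ^ 3 / U ^ 4) := by positivity
  calc _ ≤ _ := hle
    _ = C * (4 * Real.exp 1 * B) * (T * Real.log T ^ 2 / U ^ 3) := by ring
    _ ≤ _ := by rw [mul_add]; linarith
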